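/- For every real v and every real ε with ε ≠ 4, the determinant of B^#(v, ε) equals 9ε((8 + ε)v² + ε − 1)/(ε − 4). -/

import Mathlib

/-- `u = √(1 + v²)`. -/
noncomputable def uu (v : ℝ) : ℝ := Real.sqrt (1 + v ^ 2)

/-- The dissipation matrix `B^#(v, ε) = ε·B_visc − B₁ − (9ε/(4 − ε))·B₂`. -/
noncomputable def Bsharp (v ε : ℝ) : Matrix (Fin 2) (Fin 2) ℝ :=
  ε • !![(uu v) ^ 2 * v ^ 2, -(uu v) ^ 3 * v; -(uu v) ^ 3 * v, (uu v) ^ 4]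
    - !![16 * (uu v) ^ 2 * v ^ 2, -4 * (uu v) * v * (4 * v ^ 2 + 1);
         -4 * (uu v) * v * (4 * v ^ 2 + 1), (4 * v ^ 2 + 1) ^ 2]
    - (9 * ε / (4 - ε)) • !![((uu v) ^ 2 + v ^ 2) ^ 2, -2 * ((uu v) ^ 2 + v ^ 2) * (uu v) * v;
         -2 * ((uu v) ^ 2 + v ^ 2) * (uu v) * v, 4 * (uu v) ^ 2 * v ^ 2]

/-- The matrix `A(v)` of the scaled linearization. -/
noncomputable def Amat (v : ℝ) : Matrix (Fin 2) (Fin 2) ℝ :=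
  !![v * (6 * v ^ 2 + 5), -(uu v) * (6 * v ^ 2 + 1);
     -(uu v) * (6 * v ^ 2 + 1), 3 * v * (2 * v ^ 2 + 1)]

theorem uu_sq (v : ℝ) : uu v ^ 2 = 1 + v ^ 2 :=
  Real.sq_sqrt (by positivity)

/-- `det B^#(v, ε) = 9ε((8 + ε)v² + ε − 1)/(ε − 4)`. -/
theorem det_Bsharp (v ε : ℝ) (hε : ε ≠ 4) :
    (Bsharp v ε).det = 9 * ε * ((8 + ε) * v ^ 2 + ε - 1) / (ε - 4) := by
  have hu : uu v ^ 2 = 1 + v ^ 2 := uu_sq v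
  have hu3 : uu v ^ 3 = (1 + v ^ 2) * uu v := by rw [← hu]; ring
  have hu4 : uu v ^ 4 = (1 + v ^ 2) ^ 2 := by rw [← hu]; ring
  have h₁ : 4 - ε ≠ 0 := sub_ne_zero.mpr hε.symm
  have h₂ : ε - 4 ≠ 0 := sub_ne_zero.mpr hε
  have hc : 9 * ε / (4 - ε) * (ε - 4) = -(9 * ε) := by field_simp; ring
  rw [eq_div_iff h₂]
  simp only [Bsharp, Matrix.det_fin_two, Matrix.sub_apply, Matrix.smul_apply, Matrix.of_apply,
    Matrix.cons_val', Matrix.cons_val_zero, Matrix.cons_val_one, Matrix.cons_val_fin_one,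
    smul_eq_mul, hu, hu3, hu4]
  generalize 9 * ε / (4 - ε) = c at hc ⊢
  ring_nf
  simp only [hu]
  linear_combination (ε * (1 + v ^ 2) ^ 2 - (1 - 2 * v ^ 2) ^ 2) * (-1) * hc
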